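/- arXiv:1305.1744 — 4 statements merged into one kernel-verified Lean document; each statement's English description precedes it below -/
import Mathlib

section
/- Let α' be a suffix of α with |α'| > |α^a|. Then α' occurs at least twice in B if and only if N(α') ≥ 2, where N(α') is the number of suffixes of A having α' as a prefix plus the number of suffixes of α^aδγ of length greater than |γ| having α' as a prefix. (This is Lemma 1: the number of α'-leaves in the intermediate tree T', which has one leaf for each suffix of A and one additional leaf for each suffix of α^aδγ longer than γ, is at least two exactly when α' occurs at least twice in B.) -/
/-- A string `χ` occurs in `S` at position `p` if `S = u ++ χ ++ v` with `|u| = p`. -/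
def OccursAt {σ : Type*} (χ S : List σ) (p : ℕ) : Prop :=
  ∃ u v : List σ, S = u ++ χ ++ v ∧ u.length = p

/-- A string `χ` occurs at least twice in `S` if it occurs at two distinct positions. -/
def OccursTwice {σ : Type*} (χ S : List σ) : Prop :=
  ∃ p q : ℕ, p ≠ q ∧ OccursAt χ S p ∧ OccursAt χ S q

/-- The number of suffixes of `S` having `χ` as a prefix. -/
def countSuffixesWithPrefix {σ : Type*} [DecidableEq σ] (χ S : List σ) : ℕ :=
  ((Finset.range (S.length + 1)).filter (fun j => χ <+: S.drop j)).card

/-- The number of suffixes of `S` of length greater than `ℓ` having `χ` as a prefix. -/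
def countLongSuffixesWithPrefix {σ : Type*} [DecidableEq σ] (χ S : List σ) (ℓ : ℕ) : ℕ :=
  ((Finset.range (S.length + 1)).filter
    (fun j => ℓ < (S.drop j).length ∧ χ <+: S.drop j)).card

theorem occursAt_iff {σ : Type*} {χ S : List σ} {p : ℕ} :
    OccursAt χ S p ↔ p ≤ S.length ∧ χ <+: S.drop p := by
  constructor
  · rintro ⟨u, v, rfl, rfl⟩
    refine ⟨by simp, v, ?_⟩
    simp
  · rintro ⟨hp, v, hv⟩
    refine ⟨S.take p, v, ?_, by simpa using hp⟩
    rw [List.append_assoc, hv, List.take_append_drop]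

theorem OccursAt.append_right {σ : Type*} {χ S : List σ} {p : ℕ} (h : OccursAt χ S p)
    (T : List σ) : OccursAt χ (S ++ T) p := by
  obtain ⟨u, v, rfl, rfl⟩ := h
  exact ⟨u, v ++ T, by simp, rfl⟩

theorem OccursAt.append_left {σ : Type*} {χ S : List σ} {p : ℕ} (h : OccursAt χ S p)
    (T : List σ) : OccursAt χ (T ++ S) (T.length + p) := by
  obtain ⟨u, v, rfl, rfl⟩ := h
  exact ⟨T ++ u, v, by simp, by simp⟩

theorem OccursAt.of_prefix {σ : Type*} {χ ψ S : List σ} {p : ℕ} (h : OccursAt χ S p)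
    (hψ : ψ <+: χ) : OccursAt ψ S p := by
  rw [occursAt_iff] at h ⊢
  exact ⟨h.1, hψ.trans h.2⟩

theorem OccursAt.of_append_right {σ : Type*} {χ S T : List σ} {p : ℕ}
    (h : OccursAt χ (S ++ T) p) (hp : p + χ.length ≤ S.length) : OccursAt χ S p := by
  rw [occursAt_iff] at h ⊢
  refine ⟨by omega, ?_⟩
  rw [List.drop_append_of_le_length (by omega)] at h
  exact List.prefix_of_prefix_length_le h.2 (List.prefix_append _ _) (by simp; omega)

theorem OccursAt.of_append_left {σ : Type*} {χ S T : List σ} {p : ℕ}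
    (h : OccursAt χ (T ++ S) (T.length + p)) : OccursAt χ S p := by
  rw [occursAt_iff] at h ⊢
  simpa [List.drop_length_add_append] using h

/-- An occurrence running past the end of `S` starts with a suffix of `S`. -/
theorem OccursAt.drop_prefix {σ : Type*} {χ S T : List σ} {p : ℕ}
    (h : OccursAt χ (S ++ T) p) (hp : p ≤ S.length) (hpχ : S.length ≤ p + χ.length) :
    S.drop p <+: χ := by
  rw [occursAt_iff, List.drop_append_of_le_length hp] at h
  exact List.prefix_of_prefix_length_le (List.prefix_append _ _) h.2 (by simp; omega)

theorem occursAt_drop {σ : Type*} {S : List σ} {p : ℕ} (hp : p ≤ S.length) :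
    OccursAt (S.drop p) S p :=
  occursAt_iff.2 ⟨hp, List.prefix_rfl⟩

theorem one_le_countSuffixesWithPrefix {σ : Type*} [DecidableEq σ] {χ S : List σ} {p : ℕ}
    (h : OccursAt χ S p) : 1 ≤ countSuffixesWithPrefix χ S := by
  rw [occursAt_iff] at h
  exact Finset.card_pos.2 ⟨p, by simpa [Nat.lt_succ_iff] using h⟩

theorem countSuffixesWithPrefix_le_one {σ : Type*} [DecidableEq σ] {χ S : List σ}
    (h : ¬ OccursTwice χ S) : countSuffixesWithPrefix χ S ≤ 1 := by
  refine Finset.card_le_one.2 fun p hp q hq => ?_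
  by_contra hpq
  simp only [Finset.mem_filter, Finset.mem_range, Nat.lt_succ_iff] at hp hq
  exact h ⟨p, q, hpq, occursAt_iff.2 hp, occursAt_iff.2 hq⟩

theorem one_le_countLongSuffixesWithPrefix_iff {σ : Type*} [DecidableEq σ] {χ S : List σ}
    {ℓ : ℕ} :
    1 ≤ countLongSuffixesWithPrefix χ S ℓ ↔ ∃ p, p + ℓ < S.length ∧ OccursAt χ S p := by
  rw [countLongSuffixesWithPrefix, Nat.one_le_iff_ne_zero, ← Nat.pos_iff_ne_zero,
    Finset.card_pos]
  simp only [Finset.Nonempty, Finset.mem_filter, Finset.mem_range, List.length_drop,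
    occursAt_iff]
  refine exists_congr fun p => ⟨fun ⟨_, _, h⟩ => ⟨by omega, by omega, h⟩,
    fun ⟨_, _, h⟩ => ⟨by omega, by omega, h⟩⟩

/-- Suppose no suffix of `κ ++ αa` longer than `αa` occurs twice in `κ ++ αa ++ β ++ γ`. Then any
occurrence of such a suffix in `κ ++ αa ++ δ ++ γ`, other than the one ending `κ ++ αa`, starts
within `αa ++ δ`. -/
theorem OccursAt.bounds_of_ne {σ : Type*} {κ αa β γ δ ρ χ : List σ} {q : ℕ}
    (hmax : ∀ ψ : List σ, ψ <:+ κ ++ αa → αa.length < ψ.length →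
      ¬ OccursTwice ψ (κ ++ αa ++ β ++ γ))
    (hχ : ρ ++ χ = κ ++ αa) (hlen : αa.length < χ.length)
    (hq : OccursAt χ (κ ++ αa ++ δ ++ γ) q) (hne : ρ.length ≠ q) :
    κ.length ≤ q ∧ q < (κ ++ αa ++ δ).length := by
  have hρ : ρ.length + χ.length = κ.length + αa.length := by
    simpa using congrArg List.length hχ
  have hsuf : χ <:+ κ ++ αa := ⟨ρ, hχ⟩
  have hfirst : OccursAt χ (κ ++ αa) ρ.length := ⟨ρ, [], by simp [hχ], rfl⟩
  have inA {ψ : List σ} {p : ℕ} (h : OccursAt ψ (κ ++ αa) p) :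
      OccursAt ψ (κ ++ αa ++ β ++ γ) p := (h.append_right β).append_right γ
  constructor
  · by_contra! hlt
    rw [List.append_assoc _ δ γ] at hq
    by_cases hfit : q + χ.length ≤ (κ ++ αa).length
    · exact hmax χ hsuf hlen ⟨_, q, hne, inA hfirst, inA (hq.of_append_right hfit)⟩
    · have hqle : q ≤ (κ ++ αa).length := by rw [List.length_append]; omega
      refine hmax ((κ ++ αa).drop q) (List.drop_suffix _ _) (by simp; omega)
        ⟨_, q, hne, inA (hfirst.of_prefix (hq.drop_prefix hqle (by omega))),
          inA (occursAt_drop hqle)⟩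
  · by_contra! hge
    obtain ⟨r, rfl⟩ := Nat.exists_eq_add_of_le hge
    refine hmax χ hsuf hlen ⟨_, _, ?_, inA hfirst,
      hq.of_append_left.append_left (κ ++ αa ++ β)⟩
    simp only [List.length_append]
    omega

/-- **Lemma 1.** Let `A = αβγ`, `B = αδγ`, and let `αa` be the longest suffix of `α`
occurring at least twice in `A`.  Assume `γ` is nonempty and its last symbol occurs in
`A` and in `B` only at the last position.  For any suffix `α'` of `α` longer than `αa`,
`α'` occurs at least twice in `B` iff `N(α') ≥ 2`, where `N(α')` is the number of
suffixes of `A` with prefix `α'` plus the number of suffixes of `αa ++ δ ++ γ` of length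
greater than `|γ|` with prefix `α'`. -/
theorem lemma_one {σ : Type*} [DecidableEq σ] (α β γ δ αa : List σ)
    (hαa_suf : αa <:+ α)
    (hαa_twice : OccursTwice αa (α ++ β ++ γ))
    (hαa_max : ∀ χ : List σ, χ <:+ α → αa.length < χ.length →
      ¬ OccursTwice χ (α ++ β ++ γ))
    (hγ : γ ≠ [])
    (hlastA : ∀ p : ℕ, OccursAt [γ.getLast hγ] (α ++ β ++ γ) p →
      p = (α ++ β ++ γ).length - 1)
    (hlastB : ∀ p : ℕ, OccursAt [γ.getLast hγ] (α ++ δ ++ γ) p →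
      p = (α ++ δ ++ γ).length - 1)
    (α' : List σ) (hsuf : α' <:+ α) (hlen : αa.length < α'.length) :
    OccursTwice α' (α ++ δ ++ γ) ↔
      2 ≤ countSuffixesWithPrefix α' (α ++ β ++ γ) +
          countLongSuffixesWithPrefix α' (αa ++ δ ++ γ) γ.length := by
  obtain ⟨κ, rfl⟩ := hαa_suf
  have hnot := hαa_max α' hsuf hlen
  obtain ⟨ρ, hρ⟩ := hsuf
  have hρlen : ρ.length + α'.length = κ.length + αa.length := by
    simpa using congrArg List.length hρ
  have hfirst : OccursAt α' (κ ++ αa) ρ.length := ⟨ρ, [], by simp [hρ], rfl⟩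
  have hone := one_le_countSuffixesWithPrefix ((hfirst.append_right β).append_right γ)
  have hle := countSuffixesWithPrefix_le_one hnot
  have hcount : 2 ≤ countSuffixesWithPrefix α' (κ ++ αa ++ β ++ γ) +
      countLongSuffixesWithPrefix α' (αa ++ δ ++ γ) γ.length ↔
      1 ≤ countLongSuffixesWithPrefix α' (αa ++ δ ++ γ) γ.length := by omega
  have hB : κ ++ αa ++ δ ++ γ = κ ++ (αa ++ δ ++ γ) := by simp
  rw [hcount, one_le_countLongSuffixesWithPrefix_iff]
  constructor
  · rintro ⟨p, q, hpq, hp, hq⟩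
    obtain ⟨r, hr, hne⟩ : ∃ r, OccursAt α' (κ ++ αa ++ δ ++ γ) r ∧ ρ.length ≠ r := by
      by_cases h : ρ.length = p
      · exact ⟨q, hq, h ▸ hpq⟩
      · exact ⟨p, hp, h⟩
    obtain ⟨hκ, hδ⟩ := hr.bounds_of_ne hαa_max hρ hlen hne
    obtain ⟨s, rfl⟩ := Nat.exists_eq_add_of_le hκ
    rw [hB] at hr
    refine ⟨s, ?_, hr.of_append_left⟩
    simp only [List.length_append] at hδ ⊢
    omega
  · rintro ⟨s, -, hs⟩
    exact ⟨ρ.length, κ.length + s, by omega, (hfirst.append_right δ).append_right γ,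
      hB ▸ hs.append_left κ⟩
end

section
/- Let α' be a suffix of α with |α'| > |α^a|. Then every occurrence of α' in B at a position p with p ≠ |α| − |α'| satisfies p ≥ |α| − |α^a|; that is, every occurrence of α' in B other than its occurrence as a suffix of α is contained in the suffix α^aδγ of B. -/
/-- Let `A = αβγ`, `B = αδγ`, and let `αa` be the longest suffix of `α` occurring at
least twice in `A`.  For a suffix `α'` of `α` with `|α'| > |αa|`, every occurrence of
`α'` in `B` other than its occurrence as a suffix of `α` (position `|α| - |α'|`) starts
at position at least `|α| - |αa|`, i.e., it is contained in the suffix `αaδγ` of `B`. -/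
theorem other_occurrences_contained_in_tail {σ : Type*} (α β γ δ αa : List σ)
    (hαa_suf : αa <:+ α)
    (hαa_twice : OccursTwice αa (α ++ β ++ γ))
    (hαa_max : ∀ χ : List σ, χ <:+ α → αa.length < χ.length →
      ¬ OccursTwice χ (α ++ β ++ γ))
    (α' : List σ) (hsuf : α' <:+ α) (hlen : αa.length < α'.length) :
    ∀ p : ℕ, OccursAt α' (α ++ δ ++ γ) p → p ≠ α.length - α'.length →
      α.length - αa.length ≤ p := by
  rintro p ⟨u, v, hB, rfl⟩ hp
  obtain ⟨w, hw⟩ := hsuf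
  have hw_len : w.length = α.length - α'.length := by simp [← hw]
  by_contra! hlt
  rw [List.append_assoc, List.append_assoc, List.append_eq_append_iff] at hB
  obtain ⟨c, hu, -⟩ | ⟨c, hα, hc⟩ := hB
  · simp only [hu, List.length_append] at hlt
    omega
  · obtain ⟨d, hd, -⟩ | ⟨d, hd, -⟩ := List.append_eq_append_iff.mp hc
    · refine hαa_max α' ⟨w, hw⟩ hlen
        ⟨u.length, w.length, hw_len ▸ hp, ⟨u, d ++ β ++ γ, ?_, rfl⟩, ⟨w, β ++ γ, ?_, rfl⟩⟩
      · simp [hα, hd]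
      · simp [← hw]
    · have hα_len := congrArg List.length hα
      rw [List.length_append] at hα_len
      refine hαa_max c ⟨u, hα.symm⟩ (by omega)
        ⟨u.length, w.length, hw_len ▸ hp, ⟨u, β ++ γ, ?_, rfl⟩, ⟨w, d ++ β ++ γ, ?_, rfl⟩⟩
      · simp [hα]
      · simp [← hw, hd]
end

section
/- Let α' be a suffix of α with |α'| > |α^a|. If α' occurs exactly once in B, then no suffix of α^aδγ has α' as a prefix; in particular, no suffix of α^aδγ of length greater than |γ| has α' as a prefix. -/
/-- Let `A = αβγ`, `B = αδγ`, and let `αa` be the longest suffix of `α` occurring at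
least twice in `A`.  If a suffix `α'` of `α` with `|α'| > |αa|` occurs exactly once in
`B`, then no suffix of `αaδγ` has `α'` as a prefix; in particular, no suffix of `αaδγ`
of length greater than `|γ|` has `α'` as a prefix. -/
theorem unique_occurrence_no_tail_suffix_with_prefix {σ : Type*} (α β γ δ αa : List σ)
    (hαa_suf : αa <:+ α)
    (hαa_twice : OccursTwice αa (α ++ β ++ γ))
    (hαa_max : ∀ χ : List σ, χ <:+ α → αa.length < χ.length →
      ¬ OccursTwice χ (α ++ β ++ γ))
    (α' : List σ) (hsuf : α' <:+ α) (hlen : αa.length < α'.length)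
    (honce : ∃! p : ℕ, OccursAt α' (α ++ δ ++ γ) p) :
    (∀ s : List σ, s <:+ αa ++ δ ++ γ → ¬ (α' <+: s)) ∧
      (∀ s : List σ, s <:+ αa ++ δ ++ γ → γ.length < s.length → ¬ (α' <+: s)) := by
  have no_prefix : ∀ s : List σ, s <:+ αa ++ δ ++ γ → ¬ (α' <+: s) := by
    rintro s ⟨r, hr⟩ ⟨t, rfl⟩
    obtain ⟨x, hx⟩ := hαa_suf
    obtain ⟨y, hy⟩ := hsuf
    have at_end : OccursAt α' (α ++ δ ++ γ) y.length :=
      ⟨y, δ ++ γ, by simp [← hy], rfl⟩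
    have in_tail : OccursAt α' (α ++ δ ++ γ) (x ++ r).length :=
      ⟨x ++ r, t, by simpa [← hx] using hr.symm, rfl⟩
    have heq := honce.unique at_end in_tail
    have hxy := congrArg List.length (hx.trans hy.symm)
    simp only [List.length_append] at heq hxy
    omega
  exact ⟨no_prefix, fun s hs _ => no_prefix s hs⟩
end

section
/- Every nonempty suffix of B = α_1δ_1⋯α_kδ_kα_{k+1} is of exactly one of the following forms, with the index i uniquely determined: (1) a nonempty suffix of α_{k+1}; (3) for some i with 1 ≤ i ≤ k, a suffix of α*_i δ_i R^B_i of length greater than |R^B_i|, where R^B_i = α_{i+1}δ_{i+1}⋯α_{k+1}; or (4) for some i with 1 ≤ i ≤ k, the string α'_i δ_i R^B_i for a suffix α'_i of α_i with |α'_i| > |α*_i|. -/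
/-- The string `B = α₁δ₁⋯α_kδ_kα_{k+1}` (0-based indexing). -/
def alignConcat {σ : Type*} (k : ℕ) (α : Fin (k + 1) → List σ) (δ : Fin k → List σ) :
    List σ :=
  (List.ofFn (fun j : Fin k => α j.castSucc ++ δ j)).flatten ++ α (Fin.last k)

/-- The tail `R^B_i = α_{i+1}δ_{i+1}⋯α_{k+1}` of `B` after the `i`-th different
chunk `δ_i`. -/
def alignTail {σ : Type*} (k : ℕ) (α : Fin (k + 1) → List σ) (δ : Fin k → List σ)
    (i : Fin k) : List σ :=
  ((List.ofFn (fun j : Fin k => α j.castSucc ++ δ j)).drop (i.val + 1)).flatten ++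
    α (Fin.last k)

/-- The suffix of `alignConcat k α δ` that starts at block `m` (0-based). -/
def alignSuffix {σ : Type*} (k : ℕ) (α : Fin (k + 1) → List σ) (δ : Fin k → List σ)
    (m : ℕ) : List σ :=
  ((List.ofFn (fun j : Fin k => α j.castSucc ++ δ j)).drop m).flatten ++ α (Fin.last k)

section alignSuffix

variable {σ : Type*} {k : ℕ} (α : Fin (k + 1) → List σ) (δ : Fin k → List σ)

theorem alignSuffix_val (i : Fin k) :
    alignSuffix k α δ i = α i.castSucc ++ δ i ++ alignTail k α δ i := by
  have h : i.val < (List.ofFn (fun j : Fin k => α j.castSucc ++ δ j)).length := by simp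
  simp [alignSuffix, alignTail, List.drop_eq_getElem_cons h]

theorem alignSuffix_of_le (m : ℕ) (hm : k ≤ m) : alignSuffix k α δ m = α (Fin.last k) := by
  simp [alignSuffix, List.drop_eq_nil_of_le, hm]

theorem length_alignSuffix_antitone : Antitone fun m => (alignSuffix k α δ m).length := by
  refine antitone_nat_of_succ_le fun m => ?_
  by_cases hm : m < k
  · have h : (alignSuffix k α δ m).length = _ :=
      congrArg List.length (alignSuffix_val α δ ⟨m, hm⟩)
    have h' : alignTail k α δ ⟨m, hm⟩ = alignSuffix k α δ (m + 1) := rfl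
    simp only [h, h', List.length_append]
    omega
  · simp only [alignSuffix_of_le α δ m (by omega), alignSuffix_of_le α δ (m + 1) (by omega),
      le_refl]

/-- The block of `alignConcat k α δ` in which a suffix starts is determined by its length. -/
theorem eq_of_length_alignTail_lt {n : ℕ} {i j : Fin k}
    (hi : (alignTail k α δ i).length < n)
    (hi' : n ≤ (α i.castSucc).length + (δ i).length + (alignTail k α δ i).length)
    (hj : (alignTail k α δ j).length < n)
    (hj' : n ≤ (α j.castSucc).length + (δ j).length + (alignTail k α δ j).length) :
    i = j := by
  have key : ∀ a b : Fin k, (alignTail k α δ a).length < n →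
      n ≤ (α b.castSucc).length + (δ b).length + (alignTail k α δ b).length → ¬ a < b := by
    intro a b ha hb hab
    have h : (alignSuffix k α δ b).length ≤ (alignTail k α δ a).length :=
      length_alignSuffix_antitone α δ (Nat.succ_le_of_lt hab)
    simp only [alignSuffix_val, List.length_append] at h
    omega
  exact le_antisymm (not_lt.1 (key j i hj hi')) (not_lt.1 (key i j hi hj'))

theorem length_last_le_length_alignTail (i : Fin k) :
    (α (Fin.last k)).length ≤ (alignTail k α δ i).length := by
  simp [alignTail]

/-- A suffix of `a ++ d ++ t` is a suffix of `t`, or a suffix of `b ++ d ++ t` longer than `t`,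
or extends `d ++ t` by a suffix of `a` longer than `b`, where `b` is a given suffix of `a`. -/
theorem List.IsSuffix.append_append_cases {s a b d t : List σ} (hb : b <:+ a)
    (hs : s <:+ a ++ d ++ t) :
    s <:+ t ∨ (s <:+ b ++ d ++ t ∧ t.length < s.length) ∨
      ∃ a', a' <:+ a ∧ b.length < a'.length ∧ s = a' ++ d ++ t := by
  rcases le_or_gt s.length t.length with h | h
  · exact .inl (List.suffix_of_suffix_length_le hs (List.suffix_append _ _) h)
  rcases le_or_gt s.length (b ++ d ++ t).length with h' | h'
  · refine .inr (.inl ⟨List.suffix_of_suffix_length_le hs ?_ h', h⟩)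
    obtain ⟨c, rfl⟩ := hb
    exact ⟨c, by simp⟩
  · simp only [List.length_append] at h'
    obtain ⟨a', rfl⟩ : d ++ t <:+ s :=
      List.suffix_of_suffix_length_le ⟨a, by simp⟩ hs (by simp only [List.length_append]; omega)
    simp only [List.length_append] at h'
    refine .inr (.inr ⟨a', ?_, by omega, by simp⟩)
    rw [List.append_assoc, List.suffix_append_self_iff] at hs
    exact hs

theorem alignSuffix_suffix_cases {αStar : Fin k → List σ}
    (hsuf : ∀ i : Fin k, αStar i <:+ α i.castSucc) {s : List σ} {m : ℕ} (hm : m ≤ k)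
    (hs : s <:+ alignSuffix k α δ m) :
    (s <:+ α (Fin.last k)) ∨
      (∃ i : Fin k, s <:+ αStar i ++ δ i ++ alignTail k α δ i ∧
        (alignTail k α δ i).length < s.length) ∨
      (∃ i : Fin k, ∃ α' : List σ, α' <:+ α i.castSucc ∧ (αStar i).length < α'.length ∧
        s = α' ++ δ i ++ alignTail k α δ i) := by
  induction hm using Nat.decreasingInduction with
  | self => exact .inl (alignSuffix_of_le α δ k le_rfl ▸ hs)
  | of_succ m hm ih =>
    have hs' : s <:+ _ := alignSuffix_val α δ ⟨m, hm⟩ ▸ hs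
    rcases (hsuf _).append_append_cases hs' with h | h | h
    · exact ih h
    · exact .inr (.inl ⟨_, h⟩)
    · exact .inr (.inr ⟨_, h⟩)

end alignSuffix

/-- Every nonempty suffix of `B = α₁δ₁⋯α_kδ_kα_{k+1}` is of exactly one of the forms
(1) a nonempty suffix of `α_{k+1}`, (3) a suffix of `α*_i δ_i R^B_i` of length
greater than `|R^B_i|` for some `i`, or (4) `α'_i δ_i R^B_i` for a suffix `α'_i` of
`α_i` with `|α'_i| > |α*_i|` for some `i` — and in forms (3) and (4) the index `i`
is uniquely determined. -/
theorem suffixes_of_B_classification {σ : Type*} (k : ℕ)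
    (α : Fin (k + 1) → List σ) (β δ : Fin k → List σ) (αStar : Fin k → List σ)
    (hlast : α (Fin.last k) ≠ [])
    (hsuf : ∀ i : Fin k, αStar i <:+ α i.castSucc)
    (htwice : ∀ i : Fin k,
      OccursTwice (αStar i) (alignConcat k α β) ∨ OccursTwice (αStar i) (alignConcat k α δ))
    (hmax : ∀ i : Fin k, ∀ χ : List σ, χ <:+ α i.castSucc → (αStar i).length < χ.length →
      ¬ OccursTwice χ (alignConcat k α β) ∧ ¬ OccursTwice χ (alignConcat k α δ)) :
    ∀ s : List σ, s ≠ [] → s <:+ alignConcat k α δ →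
      -- form (1): a nonempty suffix of `α_{k+1}`
      -- form (3) at index `i`: a suffix of `α*_i δ_i R^B_i` longer than `|R^B_i|`
      -- form (4) at index `i`: `α'_i δ_i R^B_i` with `α'_i <:+ α_i`, `|α'_i| > |α*_i|`
      ((s <:+ α (Fin.last k)) ∨
        (∃ i : Fin k, s <:+ αStar i ++ δ i ++ alignTail k α δ i ∧
          (alignTail k α δ i).length < s.length) ∨
        (∃ i : Fin k, ∃ α' : List σ, α' <:+ α i.castSucc ∧ (αStar i).length < α'.length ∧
          s = α' ++ δ i ++ alignTail k α δ i)) ∧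
      -- the three forms are mutually exclusive:
      ((s <:+ α (Fin.last k)) →
        (∀ i : Fin k, ¬ (s <:+ αStar i ++ δ i ++ alignTail k α δ i ∧
          (alignTail k α δ i).length < s.length)) ∧
        (∀ i : Fin k, ¬ ∃ α' : List σ, α' <:+ α i.castSucc ∧ (αStar i).length < α'.length ∧
          s = α' ++ δ i ++ alignTail k α δ i)) ∧
      (∀ i j : Fin k,
        (s <:+ αStar i ++ δ i ++ alignTail k α δ i ∧ (alignTail k α δ i).length < s.length) →
        (∃ α' : List σ, α' <:+ α j.castSucc ∧ (αStar j).length < α'.length ∧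
          s = α' ++ δ j ++ alignTail k α δ j) → False) ∧
      -- and within forms (3) and (4) the index `i` is unique:
      (∀ i j : Fin k,
        (s <:+ αStar i ++ δ i ++ alignTail k α δ i ∧ (alignTail k α δ i).length < s.length) →
        (s <:+ αStar j ++ δ j ++ alignTail k α δ j ∧ (alignTail k α δ j).length < s.length) →
        i = j) ∧
      (∀ i j : Fin k,
        (∃ α' : List σ, α' <:+ α i.castSucc ∧ (αStar i).length < α'.length ∧
          s = α' ++ δ i ++ alignTail k α δ i) →
        (∃ α' : List σ, α' <:+ α j.castSucc ∧ (αStar j).length < α'.length ∧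
          s = α' ++ δ j ++ alignTail k α δ j) →
        i = j) := by
  intro s _ hs
  have h_star (i : Fin k) := (hsuf i).length_le
  have form3 (i : Fin k) (h : s <:+ αStar i ++ δ i ++ alignTail k α δ i) :
      s.length ≤ (αStar i).length + (δ i).length + (alignTail k α δ i).length := by
    simpa [add_assoc] using h.length_le
  have form4 (i : Fin k) (h : ∃ α' : List σ, α' <:+ α i.castSucc ∧
      (αStar i).length < α'.length ∧ s = α' ++ δ i ++ alignTail k α δ i) :
      (αStar i).length + (δ i).length + (alignTail k α δ i).length < s.length ∧
        s.length ≤ (α i.castSucc).length + (δ i).length + (alignTail k α δ i).length := by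
    obtain ⟨α', h₁, h₂, rfl⟩ := h
    have := h₁.length_le
    simp only [List.length_append]
    omega
  refine ⟨alignSuffix_suffix_cases α δ hsuf k.zero_le
      (by simpa [alignSuffix, alignConcat] using hs),
    fun h => ⟨fun i hi => ?_, fun i hi => ?_⟩, fun i j hi hj => ?_, fun i j hi hj => ?_,
    fun i j hi hj => ?_⟩
  · have := h.length_le
    have := length_last_le_length_alignTail α δ i
    omega
  · have := h.length_le
    have := length_last_le_length_alignTail α δ i
    have := form4 i hi
    omega
  · have h₁ := form3 i hi.1
    have h₂ := form4 j hj
    have := h_star i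
    obtain rfl : i = j := eq_of_length_alignTail_lt α δ hi.2 (by omega) (by omega) h₂.2
    omega
  · have := form3 i hi.1
    have := form3 j hj.1
    have := h_star i
    have := h_star j
    exact eq_of_length_alignTail_lt α δ hi.2 (by omega) hj.2 (by omega)
  · have h₁ := form4 i hi
    have h₂ := form4 j hj
    exact eq_of_length_alignTail_lt α δ (by omega) h₁.2 (by omega) h₂.2
end
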